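/- Let T be a real random variable with continuous cumulative distribution function F, and let Ĝ be a random function from ℝ to ℝ, defined on the same probability space as T and jointly measurable, such that sup_{u∈ℝ} |Ĝ(u) − F(u)| ≤ ε almost surely for some constant ε ≥ 0. Then for every α ∈ (0, 1), | P( 2·min{ Ĝ(T), 1 − Ĝ(T) } < α ) − α | ≤ 2ε. -/

import Mathlib

open MeasureTheory ProbabilityTheory

/-- A continuous cumulative distribution function takes every value in `(0, 1)`. -/
lemma exists_cdf_eq_of_continuous {μ : Measure ℝ} (hc : Continuous (cdf μ)) {c : ℝ}
    (h0 : 0 < c) (h1 : c < 1) : ∃ x, cdf μ x = c := by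
  obtain ⟨a, ha⟩ := ((tendsto_cdf_atBot μ).eventually_lt_const h0).exists
  obtain ⟨b, hb⟩ := ((tendsto_cdf_atTop μ).eventually_const_lt h1).exists
  exact mem_range_of_exists_le_of_exists_ge hc ⟨a, ha.le⟩ ⟨b, hb.le⟩

section ProbabilityIntegralTransform

variable {μ : Measure ℝ} [IsProbabilityMeasure μ]

lemma measureReal_cdf_lt_le (hc : Continuous (cdf μ)) {c : ℝ} (h0 : 0 ≤ c) :
    μ.real {x | cdf μ x < c} ≤ c := by
  rcases h0.eq_or_lt with rfl | h0
  · have : {x | cdf μ x < 0} = ∅ := by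
      ext x
      simp [cdf_nonneg]
    simp [this]
  rcases le_or_gt 1 c with h1 | h1
  · exact measureReal_le_one.trans h1
  obtain ⟨x, hx⟩ := exists_cdf_eq_of_continuous hc h0 h1
  calc μ.real {y | cdf μ y < c} ≤ μ.real (Set.Iic x) := by
        refine measureReal_mono fun y hy => ?_
        rw [Set.mem_ofPred_eq, ← hx] at hy
        exact ((monotone_cdf μ).reflect_lt hy).le
    _ = c := by rw [← cdf_eq_real, hx]

lemma le_measureReal_cdf_le (hc : Continuous (cdf μ)) {c : ℝ} (h1 : c ≤ 1) :
    c ≤ μ.real {x | cdf μ x ≤ c} := by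
  rcases le_or_gt c 0 with h0 | h0
  · exact h0.trans measureReal_nonneg
  rcases h1.eq_or_lt with rfl | h1
  · simp [cdf_le_one]
  obtain ⟨x, hx⟩ := exists_cdf_eq_of_continuous hc h0 h1
  calc c = μ.real (Set.Iic x) := by rw [← cdf_eq_real, hx]
    _ ≤ μ.real {y | cdf μ y ≤ c} :=
        measureReal_mono fun y hy => (monotone_cdf μ hy).trans hx.le

lemma le_measureReal_cdf_lt (hc : Continuous (cdf μ)) {c : ℝ} (h1 : c ≤ 1) :
    c ≤ μ.real {x | cdf μ x < c} :=
  le_of_forall_lt_imp_le_of_dense fun _ hd =>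
    (le_measureReal_cdf_le hc (hd.le.trans h1)).trans
      (measureReal_mono fun _ hx => lt_of_le_of_lt hx hd)

lemma measureReal_cdf_le_le (hc : Continuous (cdf μ)) {c : ℝ} (h0 : 0 ≤ c) :
    μ.real {x | cdf μ x ≤ c} ≤ c :=
  le_of_forall_gt_imp_ge_of_dense fun _ hd =>
    (measureReal_mono fun _ hx => lt_of_le_of_lt hx hd).trans
      (measureReal_cdf_lt_le hc (h0.trans hd.le))

lemma measureReal_lt_cdf (c : ℝ) :
    μ.real {x | c < cdf μ x} = 1 - μ.real {x | cdf μ x ≤ c} := by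
  rw [← probReal_compl_eq_one_sub
    (measurableSet_le (monotone_cdf μ).measurable measurable_const)]
  congr 1
  ext x
  simp

/-- The two tails of mass `c` of a continuous distribution have mass at most `2 * c`. -/
lemma measureReal_cdf_tails_le (hc : Continuous (cdf μ)) {c : ℝ} (h0 : 0 ≤ c) :
    μ.real {x | cdf μ x < c ∨ 1 - c < cdf μ x} ≤ 2 * c := by
  have hl := measureReal_cdf_lt_le hc h0
  have hu : μ.real {x | 1 - c < cdf μ x} ≤ c := by
    rw [measureReal_lt_cdf]
    linarith [le_measureReal_cdf_le hc (c := 1 - c) (by linarith)]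
  have := measureReal_union_le (μ := μ) {x | cdf μ x < c} {x | 1 - c < cdf μ x}
  rw [Set.ofPred_or]
  linarith

/-- The two disjoint tails of mass `c` of a continuous distribution have mass at least `2 * c`. -/
lemma le_measureReal_cdf_tails (hc : Continuous (cdf μ)) {c : ℝ} (h1 : 2 * c ≤ 1) :
    2 * c ≤ μ.real {x | cdf μ x < c ∨ 1 - c < cdf μ x} := by
  have hl := le_measureReal_cdf_lt hc (c := c) (by linarith)
  have hu : c ≤ μ.real {x | 1 - c < cdf μ x} := by
    rw [measureReal_lt_cdf]
    linarith [measureReal_cdf_le_le hc (c := 1 - c) (by linarith)]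
  rw [Set.ofPred_or, measureReal_union]
  · linarith
  · refine Set.disjoint_left.2 fun x hx hx' => ?_
    rw [Set.mem_ofPred_eq] at hx hx'
    linarith
  · exact measurableSet_lt measurable_const (monotone_cdf μ).measurable

end ProbabilityIntegralTransform

/-- Accuracy of the two-sided p-value computed from an estimated distribution function:
if `Ĝ` is uniformly within `ε` of the continuous CDF `F` of `T` almost surely, then the
p-value `2·min(Ĝ(T), 1 − Ĝ(T))` has sub-`α` probability within `2ε` of `α`. -/
theorem p_value_accuracy {Ω : Type*} [MeasureSpace Ω]
    [IsProbabilityMeasure (ℙ : Measure Ω)]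
    (T : Ω → ℝ) (hT : Measurable T)
    (F : ℝ → ℝ) (hF : ∀ u, F u = (ℙ {ω | T ω ≤ u}).toReal) (hFc : Continuous F)
    (Ghat : Ω → ℝ → ℝ) (hGm : Measurable (Function.uncurry Ghat))
    (ε : ℝ) (hε : 0 ≤ ε)
    (hclose : ∀ᵐ ω ∂ℙ, ∀ u : ℝ, |Ghat ω u - F u| ≤ ε)
    (α : ℝ) (hα0 : 0 < α) (hα1 : α < 1) :
    |(ℙ {ω | 2 * min (Ghat ω (T ω)) (1 - Ghat ω (T ω)) < α}).toReal - α| ≤ 2 * ε := by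
  have : IsProbabilityMeasure ((ℙ : Measure Ω).map T) :=
    Measure.isProbabilityMeasure_map hT.aemeasurable
  obtain rfl : F = cdf ((ℙ : Measure Ω).map T) := by
    ext u
    rw [hF, cdf_eq_real, map_measureReal_apply hT measurableSet_Iic]
    rfl
  set F := cdf ((ℙ : Measure Ω).map T)
  have hmap (c : ℝ) : ((ℙ : Measure Ω).map T).real {x | F x < c ∨ 1 - c < F x} =
      (ℙ : Measure Ω).real {ω | F (T ω) < c ∨ 1 - c < F (T ω)} :=
    map_measureReal_apply hT
      ((measurableSet_lt hFc.measurable measurable_const).union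
        (measurableSet_lt measurable_const hFc.measurable))
  have hevent (ω : Ω) : 2 * min (Ghat ω (T ω)) (1 - Ghat ω (T ω)) < α ↔
      Ghat ω (T ω) < α / 2 ∨ 1 - α / 2 < Ghat ω (T ω) := by
    rw [← lt_div_iff₀' two_pos, min_lt_iff, sub_lt_comm]
  simp_rw [hevent]
  have hupper : (ℙ : Measure Ω).real {ω | Ghat ω (T ω) < α / 2 ∨ 1 - α / 2 < Ghat ω (T ω)} ≤
      (ℙ : Measure Ω).real {ω | F (T ω) < α / 2 + ε ∨ 1 - (α / 2 + ε) < F (T ω)} := by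
    refine ENNReal.toReal_mono (measure_ne_top _ _) (measure_mono_ae ?_)
    filter_upwards [hclose] with ω hω h
    have := abs_le.1 (hω (T ω))
    exact h.imp (fun h => by linarith) (fun h => by linarith)
  have hlower : (ℙ : Measure Ω).real {ω | F (T ω) < α / 2 - ε ∨ 1 - (α / 2 - ε) < F (T ω)} ≤
      (ℙ : Measure Ω).real {ω | Ghat ω (T ω) < α / 2 ∨ 1 - α / 2 < Ghat ω (T ω)} := by
    refine ENNReal.toReal_mono (measure_ne_top _ _) (measure_mono_ae ?_)
    filter_upwards [hclose] with ω hω h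
    have := abs_le.1 (hω (T ω))
    exact h.imp (fun h => by linarith) (fun h => by linarith)
  have hu := measureReal_cdf_tails_le hFc (c := α / 2 + ε) (by linarith)
  have hl := le_measureReal_cdf_tails hFc (c := α / 2 - ε) (by linarith)
  rw [hmap] at hu hl
  rw [← measureReal_def, abs_le]
  constructor <;> linarith
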